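/- Let n ≥ 1, let r, s be natural numbers with r + s = n, set J = diag(1_r, −1_s) and D = diag(1_r, i·1_s) ∈ GL(n,ℂ). Then the stabilizer K_J = {h ∈ O(n,ℂ) : conj(h) · J = J · h} of the 1-cocycle J under twisted conjugation is a subgroup of O(n,ℂ), and the map h ↦ D h D⁻¹ is a group isomorphism from K_J onto the indefinite real orthogonal group O(r,s;ℝ) = {k ∈ GL(n,ℝ) : kᵀ J k = J}, viewed as a subgroup of GL(n,ℂ) via real matrices. -/

import Mathlib

open Matrix

/-- The diagonal matrix `J = diag(1_r, −1_s)`. -/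
def signatureMatrix (n r : ℕ) : Matrix (Fin n) (Fin n) ℂ :=
  Matrix.diagonal (fun i => if (i : ℕ) < r then (1 : ℂ) else -1)

/-- The diagonal matrix `D = diag(1_r, i·1_s)`. -/
def halfSignatureMatrix (n r : ℕ) : Matrix (Fin n) (Fin n) ℂ :=
  Matrix.diagonal (fun i => if (i : ℕ) < r then (1 : ℂ) else Complex.I)

lemma halfSignatureMatrix_mul_self (n r : ℕ) :
    halfSignatureMatrix n r * halfSignatureMatrix n r = signatureMatrix n r := by
  simp only [halfSignatureMatrix, signatureMatrix, diagonal_mul_diagonal]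
  congr 1
  ext i
  split_ifs <;> simp

lemma signatureMatrix_mul_self (n r : ℕ) : signatureMatrix n r * signatureMatrix n r = 1 := by
  simp only [signatureMatrix, diagonal_mul_diagonal, ← diagonal_one]
  congr 1
  ext i
  split_ifs <;> simp

lemma signatureMatrix_mul_halfSignatureMatrix (n r : ℕ) :
    signatureMatrix n r * halfSignatureMatrix n r =
      halfSignatureMatrix n r * signatureMatrix n r := by
  simp only [halfSignatureMatrix, signatureMatrix, diagonal_mul_diagonal, mul_comm]

lemma halfSignatureMatrix_inv (n r : ℕ) :
    (halfSignatureMatrix n r)⁻¹ = halfSignatureMatrix n r * signatureMatrix n r :=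
  inv_eq_right_inv <| by
    rw [← mul_assoc, halfSignatureMatrix_mul_self, signatureMatrix_mul_self]

lemma isUnit_halfSignatureMatrix (n r : ℕ) : IsUnit (halfSignatureMatrix n r) :=
  .of_mul_eq_one (halfSignatureMatrix n r * signatureMatrix n r) <| by
    rw [← mul_assoc, halfSignatureMatrix_mul_self, signatureMatrix_mul_self]

lemma transpose_signatureMatrix (n r : ℕ) : (signatureMatrix n r)ᵀ = signatureMatrix n r :=
  diagonal_transpose _

lemma transpose_halfSignatureMatrix (n r : ℕ) :
    (halfSignatureMatrix n r)ᵀ = halfSignatureMatrix n r :=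
  diagonal_transpose _

lemma map_star_signatureMatrix (n r : ℕ) :
    (signatureMatrix n r).map (star : ℂ → ℂ) = signatureMatrix n r := by
  rw [signatureMatrix, diagonal_map (star_zero ℂ)]
  congr 1
  ext i
  split_ifs <;> simp

lemma map_star_halfSignatureMatrix (n r : ℕ) :
    (halfSignatureMatrix n r).map (star : ℂ → ℂ) =
      halfSignatureMatrix n r * signatureMatrix n r := by
  rw [halfSignatureMatrix, signatureMatrix, diagonal_map (star_zero ℂ), diagonal_mul_diagonal]
  congr 1
  ext i
  split_ifs <;> simp

lemma Matrix.map_star_mul {l m n : Type*} [Fintype m] (A : Matrix l m ℂ) (B : Matrix m n ℂ) :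
    (A * B).map (star : ℂ → ℂ) = A.map (star : ℂ → ℂ) * B.map (star : ℂ → ℂ) :=
  Matrix.map_mul (f := starRingEnd ℂ)

lemma Matrix.forall_im_eq_zero_iff_map_star_eq {m n : Type*} (A : Matrix m n ℂ) :
    (∀ i j, (A i j).im = 0) ↔ A.map (star : ℂ → ℂ) = A := by
  simp only [← Matrix.ext_iff, map_apply]
  exact forall₂_congr fun _ _ => Complex.conj_eq_iff_im.symm

/-- `D h D⁻¹` is real exactly when `h` satisfies the twisted commutation relation with `J`. -/
lemma map_star_conj_halfSignatureMatrix_iff {n r : ℕ} (h : Matrix (Fin n) (Fin n) ℂ) :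
    (halfSignatureMatrix n r * h * (halfSignatureMatrix n r)⁻¹).map (star : ℂ → ℂ) =
        halfSignatureMatrix n r * h * (halfSignatureMatrix n r)⁻¹ ↔
      h.map (star : ℂ → ℂ) * signatureMatrix n r = signatureMatrix n r * h := by
  have hD := isUnit_halfSignatureMatrix n r
  have hJ : IsUnit (signatureMatrix n r) := .of_mul_eq_one _ (signatureMatrix_mul_self n r)
  have hJJ := signatureMatrix_mul_self n r
  rw [halfSignatureMatrix_inv, Matrix.map_star_mul, Matrix.map_star_mul, Matrix.map_star_mul,
    map_star_halfSignatureMatrix, map_star_signatureMatrix]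
  simp only [← mul_assoc]
  rw [hJ.mul_left_inj]
  simp only [mul_assoc]
  rw [hD.mul_right_inj, ← signatureMatrix_mul_halfSignatureMatrix]
  simp only [← mul_assoc]
  rw [hD.mul_left_inj, ← hJ.mul_right_inj]
  simp only [← mul_assoc, hJJ, one_mul]

/-- `D h D⁻¹` preserves the form `J` exactly when `h` is complex orthogonal. -/
lemma conj_halfSignatureMatrix_preserves_iff {n r : ℕ} (h : Matrix (Fin n) (Fin n) ℂ) :
    (halfSignatureMatrix n r * h * (halfSignatureMatrix n r)⁻¹)ᵀ * signatureMatrix n r *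
        (halfSignatureMatrix n r * h * (halfSignatureMatrix n r)⁻¹) = signatureMatrix n r ↔
      hᵀ * h = 1 := by
  set D := halfSignatureMatrix n r
  set J := signatureMatrix n r
  have hD : IsUnit D := isUnit_halfSignatureMatrix n r
  have hDJD : D * J * D = 1 := by
    rw [← signatureMatrix_mul_halfSignatureMatrix, mul_assoc, halfSignatureMatrix_mul_self,
      signatureMatrix_mul_self]
  have key : (D * h * D⁻¹)ᵀ * J * (D * h * D⁻¹) = D⁻¹ * (hᵀ * h) * D⁻¹ := by
    rw [transpose_mul, transpose_mul, transpose_nonsing_inv, transpose_halfSignatureMatrix]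
    calc D⁻¹ * (hᵀ * D) * J * (D * h * D⁻¹) = D⁻¹ * hᵀ * (D * J * D) * h * D⁻¹ := by
          simp only [mul_assoc]
      _ = D⁻¹ * (hᵀ * h) * D⁻¹ := by rw [hDJD]; simp only [mul_assoc, one_mul]
  have hJ : J = D⁻¹ * 1 * D⁻¹ := by
    rw [mul_one, ← Matrix.mul_inv_rev, halfSignatureMatrix_mul_self,
      inv_eq_right_inv (signatureMatrix_mul_self n r)]
  have hDi : IsUnit D⁻¹ := (isUnit_nonsing_inv_iff).mpr hD
  rw [key]
  conv_lhs => rw [hJ]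
  rw [hDi.mul_left_inj, hDi.mul_right_inj]

/-- Let `n ≥ 1`, `r + s = n`, `J = diag(1_r, −1_s)` and
`D = diag(1_r, i·1_s)`. The stabilizer `K_J = {h ∈ O(n,ℂ) | conj(h) · J = J · h}` of the
cocycle `J` under twisted conjugation is a subgroup of `O(n,ℂ)`, and `h ↦ D h D⁻¹` is a
group isomorphism from `K_J` onto the indefinite real orthogonal group
`O(r,s;ℝ) = {k ∈ GL(n,ℝ) | kᵀ J k = J}`, viewed inside `GL(n,ℂ)` via real matrices:
the map is multiplicative, injective on `K_J`, lands in `O(r,s;ℝ)`, and hits every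
element of `O(r,s;ℝ)`. -/
theorem stabilizer_iso_indefinite_orthogonal (n : ℕ) (hn : 1 ≤ n)
    (r s : ℕ) (hrs : r + s = n) :
    let J := signatureMatrix n r
    let D := halfSignatureMatrix n r
    let K : Set (Matrix (Fin n) (Fin n) ℂ) :=
      {h | hᵀ * h = 1 ∧ h.map (star : ℂ → ℂ) * J = J * h}
    -- `K_J` is a subgroup of `O(n,ℂ)`
    ((1 : Matrix (Fin n) (Fin n) ℂ) ∈ K) ∧
    (∀ a b, a ∈ K → b ∈ K → a * b ∈ K) ∧
    (∀ a, a ∈ K → a⁻¹ ∈ K) ∧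
    -- `h ↦ D h D⁻¹` lands in `O(r,s;ℝ)` (real, invertible, preserving `J`)
    (∀ h ∈ K,
      (∀ i j, ((D * h * D⁻¹) i j).im = 0) ∧
      IsUnit (D * h * D⁻¹) ∧
      (D * h * D⁻¹)ᵀ * J * (D * h * D⁻¹) = J) ∧
    -- it is a group homomorphism, injective on `K_J` and surjective onto `O(r,s;ℝ)`
    (∀ a b, a ∈ K → b ∈ K → D * (a * b) * D⁻¹ = (D * a * D⁻¹) * (D * b * D⁻¹)) ∧
    (∀ a b, a ∈ K → b ∈ K → D * a * D⁻¹ = D * b * D⁻¹ → a = b) ∧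
    (∀ m : Matrix (Fin n) (Fin n) ℂ, (∀ i j, (m i j).im = 0) → IsUnit m →
      mᵀ * J * m = J → ∃ h ∈ K, D * h * D⁻¹ = m) := by
  intro J D K
  have hdet : IsUnit D.det := (isUnit_iff_isUnit_det D).mp (isUnit_halfSignatureMatrix n r)
  have hD : IsUnit D := isUnit_halfSignatureMatrix n r
  have hDi : IsUnit D⁻¹ := isUnit_nonsing_inv_iff.mpr hD
  have conj_inj : ∀ a b, D * a * D⁻¹ = D * b * D⁻¹ → a = b := fun a b hab =>
    hD.mul_right_inj.mp (hDi.mul_left_inj.mp hab)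
  refine ⟨⟨by simp, ?_⟩, ?_, ?_, ?_, ?_, fun a b _ _ => conj_inj a b, ?_⟩
  · rw [Matrix.map_one _ (star_zero ℂ) (star_one ℂ), one_mul, mul_one]
  · rintro a b ⟨ha, ha'⟩ ⟨hb, hb'⟩
    refine ⟨?_, ?_⟩
    · rw [transpose_mul, mul_assoc, ← mul_assoc aᵀ, ha, one_mul, hb]
    · rw [Matrix.map_star_mul, mul_assoc, hb', ← mul_assoc, ha', mul_assoc]
  · rintro a ⟨ha, ha'⟩
    have ha₂ : a * aᵀ = 1 := mul_eq_one_comm.mp ha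
    rw [inv_eq_left_inv ha]
    refine ⟨by rw [transpose_transpose, ha₂], ?_⟩
    have := congrArg transpose ha'
    rw [transpose_mul, transpose_mul, transpose_signatureMatrix, ← transpose_map] at this
    have hJJ : J * J = 1 := signatureMatrix_mul_self n r
    calc aᵀ.map (star : ℂ → ℂ) * J = J * (J * aᵀ.map (star : ℂ → ℂ)) * J := by
          rw [← mul_assoc, hJJ, one_mul]
      _ = J * aᵀ := by rw [this, mul_assoc, mul_assoc, hJJ, mul_one]
  · rintro h ⟨hh, hh'⟩
    refine ⟨(forall_im_eq_zero_iff_map_star_eq _).mpr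
      ((map_star_conj_halfSignatureMatrix_iff h).mpr hh'), ?_,
      (conj_halfSignatureMatrix_preserves_iff h).mpr hh⟩
    exact (hD.mul (.of_mul_eq_one_right _ hh)).mul hDi
  · intro a b _ _
    simp only [mul_assoc, nonsing_inv_mul_cancel_left _ _ hdet]
  · intro m hm _ hmJ
    have hconj : D * (D⁻¹ * m * D) * D⁻¹ = m := by
      rw [← mul_assoc, mul_nonsing_inv_cancel_right _ _ hdet, ← mul_assoc,
        mul_nonsing_inv _ hdet, one_mul]
    refine ⟨D⁻¹ * m * D, ⟨(conj_halfSignatureMatrix_preserves_iff (r := r) _).mp ?_,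
      (map_star_conj_halfSignatureMatrix_iff (r := r) _).mp ?_⟩, hconj⟩
    · change (D * (D⁻¹ * m * D) * D⁻¹)ᵀ * J * (D * (D⁻¹ * m * D) * D⁻¹) = J
      rw [hconj, hmJ]
    · change (D * (D⁻¹ * m * D) * D⁻¹).map (star : ℂ → ℂ) = D * (D⁻¹ * m * D) * D⁻¹
      rw [hconj, ← forall_im_eq_zero_iff_map_star_eq]
      exact hm
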